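/- Let U be an ultrafilter on a countably infinite set X and let I ⊆ U* be an ideal on X such that U has the I-pseudo-intersection property. Then U·U ≤_T U × ∏_{n<ω} I, where I is ordered by ⊆. -/

import Mathlib

open Set

/-- A subset `S` is bounded with respect to the relation `r`. -/
def RelBounded {α : Type*} (r : α → α → Prop) (S : Set α) : Prop :=
  ∃ b, ∀ a ∈ S, r a b

/-- Tukey reducibility between two ordered sets: there is a map sending every
unbounded set to an unbounded set. -/
def TukeyLE {α β : Type*} (ra : α → α → Prop) (rb : β → β → Prop) : Prop :=
  ∃ f : α → β, ∀ S : Set α, ¬ RelBounded ra S → ¬ RelBounded rb (f '' S)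

/-- Tukey equivalence. -/
def TukeyEquiv {α β : Type*} (ra : α → α → Prop) (rb : β → β → Prop) : Prop :=
  TukeyLE ra rb ∧ TukeyLE rb ra

/-- `S` is cofinal with respect to the relation `r`. -/
def IsCofinalIn {α : Type*} (r : α → α → Prop) (S : Set α) : Prop :=
  ∀ a, ∃ b ∈ S, r a b

/-- The poset `(U, ⊇)` associated to a filter `U`: `A ≤ B` iff `A ⊇ B`. -/
def filtRel {X : Type*} (U : Filter X) :
    {A : Set X // A ∈ U} → {A : Set X // A ∈ U} → Prop :=
  fun A B => B.1 ⊆ A.1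

/-- The poset `(I, ⊆)` associated to a family of sets `I`. -/
def subRel {X : Type*} (I : Set (Set X)) :
    {A : Set X // A ∈ I} → {A : Set X // A ∈ I} → Prop :=
  fun A B => A.1 ⊆ B.1

/-- The Fubini product of filters: `A ∈ U·V` iff `{x | (A)_x ∈ V} ∈ U`,
where `(A)_x = {y | (x, y) ∈ A}`. -/
def fubini {X Y : Type*} (U : Filter X) (V : Filter Y) : Filter (X × Y) :=
  U.bind fun x => V.map (Prod.mk x)

/-- The ω-fold power of an ordered set, with the everywhere (pointwise)
domination order. -/
def seqRel {α : Type*} (r : α → α → Prop) : (ℕ → α) → (ℕ → α) → Prop :=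
  fun f g => ∀ n, r (f n) (g n)

/-- The product order on a Cartesian product of two ordered sets. -/
def prodRel {α β : Type*} (ra : α → α → Prop) (rb : β → β → Prop) :
    α × β → α × β → Prop :=
  fun p q => ra p.1 q.1 ∧ rb p.2 q.2

/-- The everywhere domination order on `ω^ω`. -/
def domRel : (ℕ → ℕ) → (ℕ → ℕ) → Prop := fun f g => ∀ n, f n ≤ g n

/-- An ideal on `X`: a family of subsets containing `∅`, closed under subsets
and finite unions. -/
def IsIdeal {X : Type*} (I : Set (Set X)) : Prop :=
  ∅ ∈ I ∧ (∀ A ∈ I, ∀ B ⊆ A, B ∈ I) ∧ (∀ A ∈ I, ∀ B ∈ I, A ∪ B ∈ I)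

/-- `U` has the `I`-pseudo-intersection property: every ω-sequence of members of `U`
has a pseudo-intersection modulo `I` in `U`. -/
def HasPIP {X : Type*} (U : Filter X) (I : Set (Set X)) : Prop :=
  ∀ A : ℕ → Set X, (∀ n, A n ∈ U) → ∃ B ∈ U, ∀ n, B \ A n ∈ I

/-- A p-point: a nonprincipal ultrafilter on `ω` which has the fin-pseudo-intersection
property. -/
def IsPPoint (U : Ultrafilter ℕ) : Prop :=
  (∀ a : ℕ, (U : Filter ℕ) ≠ pure a) ∧
  ∀ A : ℕ → Set ℕ, (∀ n, A n ∈ U) → ∃ B ∈ U, ∀ n, (B \ A n).Finite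

/-- A rapid ultrafilter: a nonprincipal ultrafilter `U` on `ω` such that for every
increasing `f : ω → ω` there is `X ∈ U` with `|X ∩ f(n)| ≤ n` for all `n`. -/
def IsRapid (U : Ultrafilter ℕ) : Prop :=
  (∀ a : ℕ, (U : Filter ℕ) ≠ pure a) ∧
  ∀ f : ℕ → ℕ, StrictMono f → ∃ X ∈ U, ∀ n, (X ∩ Set.Iio (f n)).ncard ≤ n

/-- The ideal `fin ⊗ fin` on `ω × ω`: all sets with only finitely many infinite
vertical sections. -/
def finOtimesFin : Set (Set (ℕ × ℕ)) :=
  {A | {n : ℕ | {m : ℕ | (n, m) ∈ A}.Infinite}.Finite}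

theorem mem_fubini {X Y : Type*} {U : Filter X} {V : Filter Y} {A : Set (X × Y)} :
    A ∈ fubini U V ↔ {x | {y | (x, y) ∈ A} ∈ V} ∈ U :=
  Filter.mem_bind'

/-- To show a Tukey reduction, it suffices that preimages of bounded sets are bounded. -/
theorem TukeyLE.of_bounded {α β : Type*} {ra : α → α → Prop} {rb : β → β → Prop} (f : α → β)
    (h : ∀ (S : Set α) (b : β), (∀ a ∈ S, rb (f a) b) → RelBounded ra S) : TukeyLE ra rb := by
  refine ⟨f, fun S hS hb => hS ?_⟩
  obtain ⟨b, hb⟩ := hb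
  exact h S b fun a ha => hb _ (mem_image_of_mem f ha)

/-- Under the pseudo-intersection property, the sections of `A ∈ U·U` that lie in `U` have a
common pseudo-intersection modulo `I`. -/
theorem HasPIP.exists_sections {X : Type*} {U : Filter X} {I : Set (Set X)} (hpip : HasPIP U I)
    (hI : IsIdeal I) (e : ℕ → X) (A : Set (X × X)) :
    ∃ C ∈ U, ∀ n, {y ∈ C | {z | (e n, z) ∈ A} ∈ U ∧ (e n, y) ∉ A} ∈ I := by
  obtain ⟨C, hC, h⟩ := hpip (fun n => {y | {z | (e n, z) ∈ A} ∈ U → (e n, y) ∈ A}) fun n => by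
    by_cases hn : {z | (e n, z) ∈ A} ∈ U
    · exact Filter.mem_of_superset hn fun y hy _ => hy
    · simp [hn]
  exact ⟨C, hC, fun n => hI.2.1 _ (h n) _ fun y hy => ⟨hy.1, fun h' => hy.2.2 (h' hy.2.1)⟩⟩


/-- If `U` is an ultrafilter on a countably infinite set `X`, `I ⊆ U*`
is an ideal on `X`, and `U` has the `I`-pseudo-intersection property, then
`U·U ≤_T U × ∏_{n<ω} I`. -/
theorem stmt3 {X : Type*} [Countable X] [Infinite X] (U : Ultrafilter X)
    (I : Set (Set X)) (hI : IsIdeal I) (hIU : ∀ A ∈ I, Aᶜ ∈ U)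
    (hpip : HasPIP (U : Filter X) I) :
    TukeyLE (filtRel (fubini (U : Filter X) (U : Filter X)))
      (prodRel (filtRel (U : Filter X)) (seqRel (subRel I))) := by
  obtain ⟨e, he⟩ := exists_surjective_nat X
  choose C hC hCI using hpip.exists_sections hI e
  refine TukeyLE.of_bounded
    (fun A => (⟨{x | {y | (x, y) ∈ A.1} ∈ (U : Filter X)} ∩ C A.1,
      Filter.inter_mem (mem_fubini.1 A.2) (hC A.1)⟩, fun n => ⟨_, hCI A.1 n⟩)) ?_
  rintro S ⟨⟨D, hD⟩, E⟩ hb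
  refine ⟨⟨{p | p.1 ∈ D ∧ p.2 ∈ D ∧ ∃ n, e n = p.1 ∧ p.2 ∉ (E n).1}, ?_⟩, ?_⟩
  · refine mem_fubini.2 (Filter.mem_of_superset hD fun x hx => ?_)
    obtain ⟨n, rfl⟩ := he x
    exact Filter.mem_of_superset (Filter.inter_mem hD (hIU _ (E n).2))
      fun y hy => ⟨hx, hy.1, n, rfl, hy.2⟩
  · rintro A hA ⟨x, y⟩ ⟨hx, hy, n, rfl, hn⟩
    obtain ⟨h1, h2⟩ := hb A hA
    by_contra hxy
    exact hn (h2 n ⟨(h1 hy).2, (h1 hx).1, hxy⟩)
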